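/- (Theorem 2: O(1/k) convergence of CONCORD-ISTA with constant step size.) Let C be a convex set of symmetric p×p matrices whose diagonal entries all lie in [a, b] with 0 < a ≤ b, and set L = a^{-2} + ‖S‖₂. Let {Ω^{(k)}}_{k≥0} be defined by Ω^{(k+1)} = argmin over symmetric Θ of { h2(Θ) + (L/2)‖Θ − (Ω^{(k)} − (1/L)∇h1(Ω^{(k)}))‖_F² }, and suppose Ω^{(k)} ∈ C for all k. If Ω* ∈ C minimizes Q over C, then for every k ≥ 1, Q(Ω^{(k)}) − Q(Ω*) ≤ L ‖Ω^{(0)} − Ω*‖_F² / (2k). -/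

import Mathlib

open Finset Matrix

/-- The smooth part of the CONCORD objective:
`h1(Ω) = −Σ_i log|ω_ii| + (1/2) tr(ΩSΩ)`. -/
noncomputable def h1 {p : ℕ} (S Ω : Matrix (Fin p) (Fin p) ℝ) : ℝ :=
  -(∑ i, Real.log |Ω i i|) + (1 / 2) * (Ω * S * Ω).trace

/-- The nonsmooth part of the CONCORD objective: `h2(Ω) = λ Σ_{i≠j} |ω_ij|`. -/
noncomputable def h2 {p : ℕ} (lam : ℝ) (Ω : Matrix (Fin p) (Fin p) ℝ) : ℝ :=
  lam * ∑ i, ∑ j ∈ Finset.univ.filter (fun j => j ≠ i), |Ω i j|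

/-- The CONCORD objective `Q = h1 + h2`. -/
noncomputable def Qobj {p : ℕ} (S : Matrix (Fin p) (Fin p) ℝ) (lam : ℝ)
    (Ω : Matrix (Fin p) (Fin p) ℝ) : ℝ :=
  h1 S Ω + h2 lam Ω

/-- The gradient of the smooth part of the CONCORD objective:
`∇h1(Ω) = −Ω_D⁻¹ + (1/2)(SΩ + ΩS)`. -/
noncomputable def gradH1 {p : ℕ} (S Ω : Matrix (Fin p) (Fin p) ℝ) :
    Matrix (Fin p) (Fin p) ℝ :=
  -(Matrix.diagonal fun i => Ω i i)⁻¹ + (1 / 2 : ℝ) • (S * Ω + Ω * S)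

/-- The squared Frobenius norm `‖A‖_F² = Σ_{i,j} a_ij²`. -/
def frobSq {p : ℕ} (A : Matrix (Fin p) (Fin p) ℝ) : ℝ :=
  ∑ i, ∑ j, (A i j) ^ 2

/-- The spectral norm of a positive semidefinite real symmetric matrix:
its largest eigenvalue. -/
noncomputable def specNorm {p : ℕ} (S : Matrix (Fin p) (Fin p) ℝ)
    (hS : S.IsHermitian) : ℝ :=
  ⨆ i, hS.eigenvalues i

/-- The Frobenius inner product `⟨A, B⟩ = Σ_{i,j} a_ij b_ij`. -/
def frobInner {p : ℕ} (A B : Matrix (Fin p) (Fin p) ℝ) : ℝ :=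
  ∑ i, ∑ j, A i j * B i j

section Frobenius

variable {p : ℕ}

lemma frobInner_eq_trace (A B : Matrix (Fin p) (Fin p) ℝ) :
    frobInner A B = (A * Bᵀ).trace := by
  simp [frobInner, Matrix.trace, Matrix.mul_apply]

lemma frobSq_nonneg (A : Matrix (Fin p) (Fin p) ℝ) : 0 ≤ frobSq A :=
  Finset.sum_nonneg fun _ _ => Finset.sum_nonneg fun _ _ => sq_nonneg _

lemma frobSq_sub_comm (A B : Matrix (Fin p) (Fin p) ℝ) : frobSq (A - B) = frobSq (B - A) := by
  simp only [frobSq, Matrix.sub_apply, sub_sq_comm]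

lemma frobSq_self_sub (A : Matrix (Fin p) (Fin p) ℝ) : frobSq (A - A) = 0 := by
  simp [frobSq]

lemma frobSq_sub_sub_smul (Z X G : Matrix (Fin p) (Fin p) ℝ) (c : ℝ) :
    frobSq (Z - (X - c • G))
      = frobSq (Z - X) + 2 * c * frobInner G (Z - X) + c ^ 2 * frobSq G := by
  simp only [frobSq, frobInner, Matrix.sub_apply, Matrix.smul_apply, smul_eq_mul,
    Finset.mul_sum, ← Finset.sum_add_distrib]
  exact Finset.sum_congr rfl fun i _ => Finset.sum_congr rfl fun j _ => by ring

lemma frobSq_convexComb_sub (X Z V : Matrix (Fin p) (Fin p) ℝ) (t : ℝ) :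
    frobSq ((1 - t) • X + t • Z - V)
      = (1 - t) * frobSq (X - V) + t * frobSq (Z - V) - t * (1 - t) * frobSq (Z - X) := by
  simp only [frobSq, Matrix.sub_apply, Matrix.add_apply, Matrix.smul_apply, smul_eq_mul,
    Finset.mul_sum, ← Finset.sum_add_distrib, ← Finset.sum_sub_distrib]
  exact Finset.sum_congr rfl fun i _ => Finset.sum_congr rfl fun j _ => by ring

lemma h2_convexComb_le {lam : ℝ} (hlam : 0 ≤ lam) (X Z : Matrix (Fin p) (Fin p) ℝ) {t : ℝ}
    (ht0 : 0 ≤ t) (ht1 : t ≤ 1) :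
    h2 lam ((1 - t) • X + t • Z) ≤ (1 - t) * h2 lam X + t * h2 lam Z := by
  have key : ∑ i, ∑ j ∈ Finset.univ.filter (fun j => j ≠ i), |((1 - t) • X + t • Z) i j|
      ≤ (1 - t) * (∑ i, ∑ j ∈ Finset.univ.filter (fun j => j ≠ i), |X i j|)
        + t * (∑ i, ∑ j ∈ Finset.univ.filter (fun j => j ≠ i), |Z i j|) := by
    simp only [Finset.mul_sum, ← Finset.sum_add_distrib]
    refine Finset.sum_le_sum fun i _ => Finset.sum_le_sum fun j _ => ?_
    simp only [Matrix.add_apply, Matrix.smul_apply, smul_eq_mul]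
    refine (abs_add_le _ _).trans (le_of_eq ?_)
    rw [abs_mul, abs_mul, abs_of_nonneg (sub_nonneg.2 ht1), abs_of_nonneg ht0]
  unfold h2
  linarith [mul_le_mul_of_nonneg_left key hlam]

/-- A minimizer of the proximal objective beats every other symmetric point by the
strong convexity gap. -/
lemma prox_minimizer_gap {lam L : ℝ} (hlam : 0 ≤ lam) (hL : 0 ≤ L)
    {X V : Matrix (Fin p) (Fin p) ℝ} (hX : X.IsSymm)
    (hmin : ∀ Θ : Matrix (Fin p) (Fin p) ℝ, Θ.IsSymm →
      h2 lam X + (L / 2) * frobSq (X - V) ≤ h2 lam Θ + (L / 2) * frobSq (Θ - V))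
    {Z : Matrix (Fin p) (Fin p) ℝ} (hZ : Z.IsSymm) :
    h2 lam X + (L / 2) * frobSq (X - V) + (L / 2) * frobSq (Z - X)
      ≤ h2 lam Z + (L / 2) * frobSq (Z - V) := by
  set c := (L / 2) * frobSq (Z - X) with hc
  have hc0 : 0 ≤ c := mul_nonneg (by linarith) (frobSq_nonneg _)
  have step : ∀ t : ℝ, 0 < t → t ≤ 1 →
      h2 lam X + (L / 2) * frobSq (X - V) + (1 - t) * c
        ≤ h2 lam Z + (L / 2) * frobSq (Z - V) := by
    intro t ht0 ht1
    have h := hmin ((1 - t) • X + t • Z) ((hX.smul _).add (hZ.smul _))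
    rw [frobSq_convexComb_sub] at h
    have h' := h2_convexComb_le hlam X Z ht0.le ht1
    refine le_of_mul_le_mul_left ?_ ht0
    rw [hc]
    linarith
  by_contra! hlt
  set e := h2 lam X + (L / 2) * frobSq (X - V) + c
    - (h2 lam Z + (L / 2) * frobSq (Z - V)) with he
  have he0 : 0 < e := by linarith
  have h := step (e / (2 * (c + e))) (by positivity) (by
    rw [div_le_one (by positivity)]; linarith)
  have h2 : e / (2 * (c + e)) * c ≤ e / 2 := by
    rw [div_mul_eq_mul_div, div_le_div_iff₀ (by positivity) two_pos]
    nlinarith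
  linarith

end Frobenius

section Smooth

variable {p : ℕ} {S : Matrix (Fin p) (Fin p) ℝ}

lemma Real.log_le_log_add_div {x y : ℝ} (hx : 0 < x) (hy : 0 < y) :
    Real.log y ≤ Real.log x + (y - x) / x := by
  have h := Real.log_le_sub_one_of_pos (div_pos hy hx)
  rw [Real.log_div hy.ne' hx.ne'] at h
  rw [sub_div, div_self hx.ne']
  linarith

/-- Quadratic lower bound for the logarithm on `[a, ∞)`. -/
lemma Real.log_add_div_sub_sq_le_log {a x y : ℝ} (ha : 0 < a) (hx : a ≤ x) (hy : a ≤ y) :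
    Real.log x + (y - x) / x - (a ^ 2)⁻¹ / 2 * (y - x) ^ 2 ≤ Real.log y := by
  set f : ℝ → ℝ := fun t =>
    Real.log t - (Real.log x + (t - x) / x - (a ^ 2)⁻¹ / 2 * (t - x) ^ 2) with hf
  have hx0 : 0 < x := ha.trans_le hx
  have hderiv : ∀ t, 0 < t → HasDerivAt f ((t - x) * ((a ^ 2)⁻¹ - (x * t)⁻¹)) t := by
    intro t ht
    have h1 := (hasDerivAt_id t).sub_const x
    have h := (Real.hasDerivAt_log ht.ne').sub
      (((h1.div_const x).const_add (Real.log x)).sub ((h1.pow 2).const_mul ((a ^ 2)⁻¹ / 2)))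
    refine h.congr_deriv ?_
    simp only [id]
    field_simp
    ring
  have hcurv : ∀ t, a ≤ t → 0 ≤ (a ^ 2)⁻¹ - (x * t)⁻¹ := fun t ht =>
    sub_nonneg.2 (inv_anti₀ (by positivity) (by nlinarith))
  have hfx : f x = 0 := by simp [hf]
  have hcont : ∀ t, a ≤ t → ContinuousAt f t := fun t ht =>
    (hderiv t (ha.trans_le ht)).continuousAt
  suffices h : f x ≤ f y by
    rw [hfx] at h
    exact sub_nonneg.1 h
  rcases le_total x y with hxy | hxy
  · refine monotoneOn_of_hasDerivWithinAt_nonneg (convex_Icc x y)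
      (fun t ht => (hcont t (hx.trans ht.1)).continuousWithinAt)
      (fun t ht => (hderiv t ?_).hasDerivWithinAt) (fun t ht => ?_)
      (Set.left_mem_Icc.2 hxy) (Set.right_mem_Icc.2 hxy) hxy
    · exact hx0.trans_le (interior_subset ht).1
    · have ht' := interior_subset ht
      exact mul_nonneg (sub_nonneg.2 ht'.1) (hcurv t (hx.trans ht'.1))
  · refine antitoneOn_of_hasDerivWithinAt_nonpos (convex_Icc y x)
      (fun t ht => (hcont t (hy.trans ht.1)).continuousWithinAt)
      (fun t ht => (hderiv t ?_).hasDerivWithinAt) (fun t ht => ?_)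
      (Set.left_mem_Icc.2 hxy) (Set.right_mem_Icc.2 hxy) hxy
    · exact (ha.trans_le hy).trans_le (interior_subset ht).1
    · have ht' := interior_subset ht
      exact mul_nonpos_of_nonpos_of_nonneg (sub_nonpos.2 ht'.2) (hcurv t (hy.trans ht'.1))

lemma specNorm_nonneg (hS : S.PosSemidef) : 0 ≤ specNorm S hS.1 :=
  Real.iSup_nonneg fun i => hS.eigenvalues_nonneg i

open scoped MatrixOrder in
lemma dotProduct_mulVec_le_specNorm (hS : S.IsHermitian) (x : Fin p → ℝ) :
    x ⬝ᵥ S *ᵥ x ≤ specNorm S hS * (x ⬝ᵥ x) := by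
  have h : S ≤ algebraMap ℝ _ (specNorm S hS) := by
    refine le_algebraMap_of_spectrum_le (fun r hr => ?_) hS
    rw [hS.spectrum_real_eq_range_eigenvalues] at hr
    obtain ⟨i, rfl⟩ := hr
    exact le_ciSup (Set.finite_range _).bddAbove i
  have h' := (Matrix.le_iff.1 h).dotProduct_mulVec_nonneg x
  simpa [Matrix.sub_mulVec, Algebra.algebraMap_eq_smul_one, Matrix.smul_mulVec] using h'

lemma trace_mul_mul_self_apply {D : Matrix (Fin p) (Fin p) ℝ} (hD : D.IsSymm) :
    (D * S * D).trace = ∑ i, D i ⬝ᵥ S *ᵥ D i := by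
  simp only [Matrix.trace, Matrix.diag_apply]
  refine Finset.sum_congr rfl fun i _ => ?_
  rw [Matrix.mul_assoc, Matrix.mul_apply]
  refine Finset.sum_congr rfl fun j _ => ?_
  rw [Matrix.mul_apply, Matrix.mulVec]
  congr 1
  exact Finset.sum_congr rfl fun k _ => by rw [hD.apply]

lemma trace_mul_mul_self_nonneg (hS : S.PosSemidef) {D : Matrix (Fin p) (Fin p) ℝ}
    (hD : D.IsSymm) : 0 ≤ (D * S * D).trace := by
  rw [trace_mul_mul_self_apply hD]
  exact Finset.sum_nonneg fun i _ => by simpa using hS.dotProduct_mulVec_nonneg (D i)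

lemma trace_mul_mul_self_le (hS : S.IsHermitian) {D : Matrix (Fin p) (Fin p) ℝ}
    (hD : D.IsSymm) : (D * S * D).trace ≤ specNorm S hS * frobSq D := by
  rw [trace_mul_mul_self_apply hD, frobSq, Finset.mul_sum]
  refine Finset.sum_le_sum fun i _ => ?_
  simpa [dotProduct, sq] using dotProduct_mulVec_le_specNorm hS (D i)

lemma frobInner_gradH1 {A D : Matrix (Fin p) (Fin p) ℝ} (hA : ∀ i, A i i ≠ 0)
    (hD : D.IsSymm) :
    frobInner (gradH1 S A) D
      = -(∑ i, D i i / A i i) + (1 / 2) * ((D * S * A).trace + (A * S * D).trace) := by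
  have hinv : (Matrix.diagonal fun i => A i i)⁻¹ = Matrix.diagonal fun i => (A i i)⁻¹ := by
    refine Matrix.inv_eq_right_inv ?_
    simp [Matrix.diagonal_mul_diagonal, hA]
  have hdiag : ((Matrix.diagonal fun i => (A i i)⁻¹) * D).trace = ∑ i, D i i / A i i := by
    simp [Matrix.trace, Matrix.diagonal_mul, div_eq_inv_mul]
  rw [frobInner_eq_trace, hD.eq, gradH1, hinv, Matrix.add_mul, Matrix.neg_mul,
    Matrix.smul_mul, Matrix.add_mul, Matrix.trace_add, Matrix.trace_neg, Matrix.trace_smul,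
    Matrix.trace_add, hdiag, smul_eq_mul, Matrix.trace_mul_comm (S * A) D, Matrix.mul_assoc D S A]

/-- The second-order expansion of the quadratic part of `h1`. -/
lemma h1_sub_sub_frobInner_gradH1 {A B : Matrix (Fin p) (Fin p) ℝ} (hA : ∀ i, 0 < A i i)
    (hB : ∀ i, 0 < B i i) (hAs : A.IsSymm) (hBs : B.IsSymm) :
    h1 S B - h1 S A - frobInner (gradH1 S A) (B - A)
      = (∑ i, (Real.log (A i i) + (B i i - A i i) / A i i - Real.log (B i i)))
        + (1 / 2) * ((B - A) * S * (B - A)).trace := by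
  rw [frobInner_gradH1 (fun i => (hA i).ne') (hBs.sub hAs)]
  simp only [h1, abs_of_pos (hA _), abs_of_pos (hB _), Finset.sum_sub_distrib,
    Finset.sum_add_distrib, Matrix.sub_mul, Matrix.mul_sub, Matrix.trace_sub, Matrix.sub_apply]
  ring

lemma frobInner_gradH1_le (hS : S.PosSemidef) {A B : Matrix (Fin p) (Fin p) ℝ}
    (hA : ∀ i, 0 < A i i) (hB : ∀ i, 0 < B i i) (hAs : A.IsSymm) (hBs : B.IsSymm) :
    h1 S A + frobInner (gradH1 S A) (B - A) ≤ h1 S B := by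
  have h := h1_sub_sub_frobInner_gradH1 (S := S) hA hB hAs hBs
  have hlog : 0 ≤ ∑ i, (Real.log (A i i) + (B i i - A i i) / A i i - Real.log (B i i)) :=
    Finset.sum_nonneg fun i _ => sub_nonneg.2 (Real.log_le_log_add_div (hA i) (hB i))
  linarith [trace_mul_mul_self_nonneg hS (hBs.sub hAs)]

lemma sum_diag_sq_le_frobSq (D : Matrix (Fin p) (Fin p) ℝ) : ∑ i, D i i ^ 2 ≤ frobSq D :=
  Finset.sum_le_sum fun i _ =>
    Finset.single_le_sum (f := fun j => D i j ^ 2) (fun _ _ => sq_nonneg _) (Finset.mem_univ i)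

lemma h1_le_quadratic (hS : S.IsHermitian) {a : ℝ} (ha : 0 < a)
    {A B : Matrix (Fin p) (Fin p) ℝ} (hA : ∀ i, a ≤ A i i) (hB : ∀ i, a ≤ B i i)
    (hAs : A.IsSymm) (hBs : B.IsSymm) :
    h1 S B ≤ h1 S A + frobInner (gradH1 S A) (B - A)
      + ((a ^ 2)⁻¹ + specNorm S hS) / 2 * frobSq (B - A) := by
  have h := h1_sub_sub_frobInner_gradH1 (S := S) (fun i => ha.trans_le (hA i))
    (fun i => ha.trans_le (hB i)) hAs hBs
  have hlog : ∑ i, (Real.log (A i i) + (B i i - A i i) / A i i - Real.log (B i i))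
      ≤ (a ^ 2)⁻¹ / 2 * ∑ i, (B - A) i i ^ 2 := by
    rw [Finset.mul_sum]
    refine Finset.sum_le_sum fun i _ => ?_
    rw [Matrix.sub_apply]
    linarith [Real.log_add_div_sub_sq_le_log ha (hA i) (hB i)]
  have hdiag := mul_le_mul_of_nonneg_left (sum_diag_sq_le_frobSq (B - A))
    (show 0 ≤ (a ^ 2)⁻¹ / 2 by positivity)
  linarith [trace_mul_mul_self_le hS (hBs.sub hAs)]

end Smooth

/-- The telescoping argument turning a one-step estimate into an `O(1/k)` rate. -/
lemma rate_of_step_le {q d : ℕ → ℝ} {c : ℝ} (hd : ∀ k, 0 ≤ d k)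
    (hq : ∀ k, q (k + 1) ≤ q k) (hstep : ∀ k, q (k + 1) ≤ c * (d k - d (k + 1)))
    (hc : 0 ≤ c) (k : ℕ) : k * q k ≤ c * d 0 := by
  have h : k * q k ≤ c * (d 0 - d k) := by
    induction k with
    | zero => simp
    | succ k ih =>
      push_cast
      nlinarith [hstep k, mul_le_mul_of_nonneg_left (hq k) (Nat.cast_nonneg (α := ℝ) k)]
  linarith [mul_nonneg hc (hd k)]

/-- Theorem 2: `O(1/k)` convergence of CONCORD-ISTA with constant step size:
with `L = a⁻² + ‖S‖₂` and iterates `Ω^{(k+1)} = argmin_{Θ symmetric}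
{ h2(Θ) + (L/2)‖Θ − (Ω^{(k)} − (1/L)∇h1(Ω^{(k)}))‖_F² }` staying in `C`, if `Ω*` minimizes
`Q` over `C` then `Q(Ω^{(k)}) − Q(Ω*) ≤ L‖Ω^{(0)} − Ω*‖_F²/(2k)` for every `k ≥ 1`. -/
theorem concord_ista_convergence_rate
    {p : ℕ} (hp : 0 < p) (S : Matrix (Fin p) (Fin p) ℝ) (hS : S.PosSemidef)
    (lam : ℝ) (hlam : 0 < lam)
    (C : Set (Matrix (Fin p) (Fin p) ℝ)) (hC : Convex ℝ C)
    (hCsym : ∀ A ∈ C, Matrix.IsSymm A)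
    (a b : ℝ) (ha : 0 < a) (hab : a ≤ b)
    (hCdiag : ∀ A ∈ C, ∀ i, a ≤ A i i ∧ A i i ≤ b)
    (L : ℝ) (hL : L = (a ^ 2)⁻¹ + specNorm S hS.1)
    (Ω : ℕ → Matrix (Fin p) (Fin p) ℝ)
    (hstep : ∀ k : ℕ, (Ω (k + 1)).IsSymm ∧
      ∀ Θ : Matrix (Fin p) (Fin p) ℝ, Θ.IsSymm →
        h2 lam (Ω (k + 1))
            + (L / 2) * frobSq (Ω (k + 1) - (Ω k - (1 / L) • gradH1 S (Ω k)))
          ≤ h2 lam Θ + (L / 2) * frobSq (Θ - (Ω k - (1 / L) • gradH1 S (Ω k))))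
    (hmem : ∀ k : ℕ, Ω k ∈ C)
    (Ωstar : Matrix (Fin p) (Fin p) ℝ) (hstar : Ωstar ∈ C)
    (hstarmin : ∀ Θ ∈ C, Qobj S lam Ωstar ≤ Qobj S lam Θ) :
    ∀ k : ℕ, 1 ≤ k →
      Qobj S lam (Ω k) - Qobj S lam Ωstar ≤ L * frobSq (Ω 0 - Ωstar) / (2 * k) := by
  have hL0 : 0 < L := by
    have := specNorm_nonneg hS
    rw [hL]; positivity
  have hpos : ∀ A ∈ C, ∀ i, 0 < A i i := fun A hA i => ha.trans_le (hCdiag A hA i).1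
  have hgap : ∀ k, ∀ Z ∈ C, Qobj S lam (Ω (k + 1)) - Qobj S lam Z
      ≤ (L / 2) * (frobSq (Ω k - Z) - frobSq (Ω (k + 1) - Z)) := by
    intro k Z hZ
    have hprox := prox_minimizer_gap hlam.le hL0.le (hstep k).1 (hstep k).2 (hCsym Z hZ)
    rw [frobSq_sub_sub_smul, frobSq_sub_sub_smul] at hprox
    have hup := h1_le_quadratic hS.1 ha (fun i => (hCdiag _ (hmem k) i).1)
      (fun i => (hCdiag _ (hmem (k + 1)) i).1) (hCsym _ (hmem k)) (hCsym _ (hmem (k + 1)))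
    rw [← hL] at hup
    have hlow := frobInner_gradH1_le hS (hpos _ (hmem k)) (hpos _ hZ) (hCsym _ (hmem k))
      (hCsym _ hZ)
    have hcancel : ∀ x : ℝ, L / 2 * (2 * (1 / L) * x) = x := fun x => by field_simp
    simp only [mul_add, hcancel] at hprox
    rw [frobSq_sub_comm (Ω k) Z, frobSq_sub_comm (Ω (k + 1)) Z]
    unfold Qobj
    linarith
  intro k hk
  have hrate := rate_of_step_le (q := fun k => Qobj S lam (Ω k) - Qobj S lam Ωstar)
    (d := fun k => frobSq (Ω k - Ωstar)) (c := L / 2) (fun k => frobSq_nonneg _)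
    (fun k => by
      have h := hgap k (Ω k) (hmem k)
      rw [frobSq_self_sub] at h
      have := mul_nonneg hL0.le (frobSq_nonneg (Ω (k + 1) - Ω k))
      linarith)
    (fun k => hgap k Ωstar hstar) (by positivity) k
  have hk0 : (0 : ℝ) < k := by exact_mod_cast hk
  rw [le_div_iff₀ (by positivity)]
  linarith
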